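/- Let ξ : ℂ → ℂ be the Riemann xi function, defined by ξ(s) = (s·(s−1)/2)·Λ₀(s) + 1/2, where Λ₀ is the entire completed Riemann zeta function (Mathlib's completedRiemannZeta₀); equivalently, ξ(s) = (s·(s−1)/2)·π^{−s/2}·Γ(s/2)·ζ(s) for s ≠ 0, 1. If s ∈ ℂ is a zero of ξ′, i.e. deriv ξ(s) = 0, then s lies in the critical strip: 0 ≤ Re s ≤ 1. -/

import Mathlib

/-- The Riemann xi function. -/
noncomputable def riemannXi (s : ℂ) : ℂ :=
  s * (s - 1) / 2 * completedRiemannZeta₀ s + 1 / 2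

open Complex MeasureTheory Set Filter Topology ComplexConjugate

lemma mellin_strip_bound (f : ℝ → ℂ) (hf : ∀ s, MellinConvergent f s) (A B : ℝ) :
    ∃ M : ℝ, 0 ≤ M ∧ ∀ s : ℂ, A ≤ s.re → s.re ≤ B → ‖mellin f s‖ ≤ M := by
  have hi : ∀ r : ℝ, IntegrableOn (fun t : ℝ => t ^ (r - 1) * ‖f t‖) (Ioi 0) := by
    intro r
    have := (hf r).norm
    refine this.congr ?_
    filter_upwards [ae_restrict_mem measurableSet_Ioi] with t ht
    rw [norm_smul, norm_cpow_eq_rpow_re_of_pos ht]; simp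
  refine ⟨∫ t in Ioi (0:ℝ), (t ^ (A - 1) * ‖f t‖ + t ^ (B - 1) * ‖f t‖), ?_, ?_⟩
  · apply setIntegral_nonneg measurableSet_Ioi
    intro t ht
    have ht : 0 < t := ht
    positivity
  · intro s h1 h2
    unfold mellin
    apply norm_integral_le_of_norm_le ((hi A).add (hi B))
    filter_upwards [ae_restrict_mem measurableSet_Ioi] with t ht
    have ht : 0 < t := ht
    rw [norm_smul, norm_cpow_eq_rpow_re_of_pos ht]
    simp only [sub_re, one_re]
    rcases le_total t 1 with h | h
    · have := Real.rpow_le_rpow_of_exponent_ge ht h (show A - 1 ≤ s.re - 1 by linarith)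
      have h3 : 0 ≤ t ^ (B - 1) * ‖f t‖ := by positivity
      have := mul_le_mul_of_nonneg_right this (norm_nonneg (f t))
      simp only [Pi.add_apply]
      linarith
    · have := Real.rpow_le_rpow_of_exponent_le h (show s.re - 1 ≤ B - 1 by linarith)
      have h3 : 0 ≤ t ^ (A - 1) * ‖f t‖ := by positivity
      have := mul_le_mul_of_nonneg_right this (norm_nonneg (f t))
      simp only [Pi.add_apply]
      linarith

lemma mellin_conj_of_real (f : ℝ → ℂ) (hf : ∀ t, 0 < t → conj (f t) = f t) (s : ℂ) :
    mellin f (conj s) = conj (mellin f s) := by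
  unfold mellin
  rw [← integral_conj]
  apply setIntegral_congr_fun measurableSet_Ioi
  intro t ht
  have ht : 0 < t := ht
  simp only [smul_eq_mul, map_mul, hf t ht]
  congr 1
  have e : conj s - 1 = conj (s - 1) := by simp
  rw [e, cpow_conj, conj_ofReal]
  · rw [arg_ofReal_of_nonneg ht.le]; exact Real.pi_ne_zero.symm

lemma Lam0_eq (s : ℂ) : completedRiemannZeta₀ s =
    mellin ((HurwitzZeta.hurwitzEvenFEPair 0).f_modif) (s/2) / 2 := rfl

lemma Lam0_conj (s : ℂ) : completedRiemannZeta₀ (conj s) = conj (completedRiemannZeta₀ s) := by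
  rw [Lam0_eq, Lam0_eq]
  have e2 : conj (2:ℂ) = 2 := Complex.conj_ofNat 2
  have : conj s / 2 = conj (s/2) := by rw [map_div₀, e2]
  rw [this, mellin_conj_of_real]
  · rw [map_div₀, e2]
  · intro t ht
    have h1 : (HurwitzZeta.hurwitzEvenFEPair 0).ε = 1 := rfl
    have h2 : (HurwitzZeta.hurwitzEvenFEPair 0).g₀ = 1 := rfl
    have h3 : (HurwitzZeta.hurwitzEvenFEPair 0).f₀ = 1 := by
      simp [HurwitzZeta.hurwitzEvenFEPair]
    have h4 : (HurwitzZeta.hurwitzEvenFEPair 0).f t = ((HurwitzZeta.evenKernel 0 t : ℝ) : ℂ) := rfl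
    simp only [WeakFEPair.f_modif, Pi.add_apply, map_add, indicator_apply, h1, h2, h3, h4]
    split_ifs <;> simp

lemma Lam0_strip (A B : ℝ) : ∃ M : ℝ, 0 ≤ M ∧
    ∀ s : ℂ, A ≤ s.re → s.re ≤ B → ‖completedRiemannZeta₀ s‖ ≤ M := by
  obtain ⟨M, hM, h⟩ := mellin_strip_bound (HurwitzZeta.hurwitzEvenFEPair 0).f_modif
    (fun s => ((HurwitzZeta.hurwitzEvenFEPair 0).isStrongFEPair_toStrongFEPair.hasMellin s).1)
    (A/2) (B/2)
  refine ⟨M, hM, fun s h1 h2 => ?_⟩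
  have h3 : (s/2).re = s.re/2 := by simp
  rw [Lam0_eq, norm_div]
  have := h (s/2) (by rw [h3]; linarith) (by rw [h3]; linarith)
  have h5 := norm_nonneg (mellin (HurwitzZeta.hurwitzEvenFEPair 0).f_modif (s/2))
  simp only [Complex.norm_ofNat]
  linarith

lemma LS_bound (f : ℕ → ℂ) (hf : ∀ n, ‖f n‖ ≤ 1) (a : ℝ) (ha : 1 < a) (s : ℂ) (hs : a ≤ s.re) :
    ‖LSeries f s‖ ≤ ∑' n, ‖LSeries.term 1 a n‖ := by
  have hsum : LSeriesSummable 1 (a:ℂ) := by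
    rw [LSeriesSummable_one_iff]; simpa using ha
  apply tsum_of_norm_bounded hsum.norm.hasSum
  intro n
  refine (LSeries.norm_term_le s (g := 1) (by simpa using hf n)).trans ?_
  exact LSeries.norm_term_le_of_re_le_re 1 (by simpa using hs) n

lemma zeta_bounds (a : ℝ) (ha : 1 < a) : ∃ K : ℝ, 0 ≤ K ∧ ∀ s : ℂ, a ≤ s.re →
    ‖riemannZeta s‖ ≤ K ∧ ‖(riemannZeta s)⁻¹‖ ≤ K := by
  refine ⟨∑' n, ‖LSeries.term 1 a n‖, tsum_nonneg (fun _ => norm_nonneg _), fun s hs => ?_⟩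
  have h1 : 1 < s.re := by linarith
  have hz := LSeries_one_eq_riemannZeta h1
  have hm := LSeries_one_mul_Lseries_moebius h1
  constructor
  · rw [← hz]
    exact LS_bound 1 (by simp) a ha s hs
  · rw [← hz, inv_eq_of_mul_eq_one_right hm]
    apply LS_bound _ _ a ha s hs
    intro n
    have := @ArithmeticFunction.abs_moebius_le_one n
    rw [Complex.norm_intCast]
    exact_mod_cast this

lemma norm_Gamma_le' (s : ℂ) (hs : 0 < s.re) : ‖Complex.Gamma s‖ ≤ Real.Gamma s.re := by
  rw [Complex.Gamma_eq_integral hs, Real.Gamma_eq_integral hs, Complex.GammaIntegral]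
  apply norm_integral_le_of_norm_le (Real.GammaIntegral_convergent hs)
  filter_upwards [ae_restrict_mem measurableSet_Ioi] with t ht
  rw [norm_mul, norm_cpow_eq_rpow_re_of_pos ht, Complex.norm_real, Real.norm_eq_abs, Real.abs_exp]
  simp

lemma Gamma_growth (x : ℝ) (hx : 2 ≤ x) : Real.Gamma x ≤ Real.exp (2 * x ^ (3/2:ℝ)) := by
  have h0 : (0:ℝ) < x := by linarith
  have h1 : Real.Gamma x ≤ Real.Gamma (⌊x⌋₊ + 1) :=
    Real.Gamma_strictMonoOn_Ici.monotoneOn hx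
      (by have := Nat.lt_floor_add_one x; simp only [mem_Ici]; linarith)
      (Nat.lt_floor_add_one x).le
  rw [Real.Gamma_nat_eq_factorial] at h1
  have h2 : ((⌊x⌋₊.factorial : ℕ) : ℝ) ≤ (⌊x⌋₊ : ℝ) ^ ⌊x⌋₊ := by
    exact_mod_cast Nat.factorial_le_pow _
  have h3 : (⌊x⌋₊ : ℝ) ≤ x := Nat.floor_le h0.le
  have h4 : (⌊x⌋₊ : ℝ) ^ ⌊x⌋₊ ≤ x ^ ⌊x⌋₊ := by gcongr
  have h5 : x ^ ⌊x⌋₊ ≤ x ^ x := by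
    rw [← Real.rpow_natCast]
    exact Real.rpow_le_rpow_of_exponent_le (by linarith) h3
  have h6 : x ^ x ≤ (Real.exp (2 * √x)) ^ x := by
    apply Real.rpow_le_rpow h0.le _ h0.le
    have := Real.add_one_le_exp (√x)
    have h7 : √x ≤ Real.exp (√x) := by linarith
    calc x = √x * √x := (Real.mul_self_sqrt h0.le).symm
      _ ≤ Real.exp (√x) * Real.exp (√x) := by gcongr
      _ = _ := by rw [← Real.exp_add]; ring_nf
  have h8 : (Real.exp (2 * √x)) ^ x = Real.exp (2 * x ^ (3/2:ℝ)) := by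
    rw [← Real.exp_mul]
    congr 1
    rw [Real.sqrt_eq_rpow, show (3/2:ℝ) = 1/2 + 1 by norm_num, Real.rpow_add_one h0.ne']
    ring
  linarith

lemma Gamma_inv_bound : ∃ M : ℝ, 0 ≤ M ∧ ∀ z : ℂ, 0 ≤ z.re →
    ‖(Complex.Gamma z)⁻¹‖ ≤ M * Real.exp (Real.pi * ‖z‖) := by
  obtain ⟨M1, h1⟩ := (isCompact_closedBall (0:ℂ) 2).exists_bound_of_continuousOn
    (Complex.differentiable_one_div_Gamma.continuous.continuousOn)
  obtain ⟨M2, h2⟩ := (isCompact_Icc (a := (1/2:ℝ)) (b := 3/2)).exists_bound_of_continuousOn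
    (f := Real.Gamma) (fun x hx => (Real.differentiableAt_Gamma (fun m => by
      have : (0:ℝ) ≤ m := m.cast_nonneg
      have := hx.1
      intro h; linarith)).continuousAt.continuousWithinAt)
  set M := max 0 (max M1 M2)
  have hM0 : 0 ≤ M := le_max_left _ _
  have hM1 : M1 ≤ M := (le_max_left _ _).trans (le_max_right _ _)
  have hM2 : M2 ≤ M := (le_max_right _ _).trans (le_max_right _ _)
  have key : ∀ n : ℕ, ∀ z : ℂ, -1/2 ≤ z.re → z.re ≤ 1/2 + n →
      ‖(Complex.Gamma z)⁻¹‖ ≤ M * Real.exp (Real.pi * ‖z‖) := by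
    intro n
    induction n with
    | zero =>
      intro z hz1 hz2
      simp only [Nat.cast_zero, add_zero] at hz2
      have e1 : Complex.Gamma z * Complex.Gamma (1 - z) = Real.pi / Complex.sin (Real.pi * z) :=
        Complex.Gamma_mul_Gamma_one_sub z
      have hg : Complex.Gamma (1 - z) ≠ 0 := by
        apply Complex.Gamma_ne_zero_of_re_pos; simp; linarith
      have e2 : (Complex.Gamma z)⁻¹ = Complex.Gamma (1 - z) * (Complex.sin (Real.pi * z) / Real.pi) := by
        rw [eq_div_of_mul_eq hg e1, inv_div, div_div_eq_mul_div, mul_div_assoc]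
      have e3 : ‖Complex.sin (Real.pi * z)‖ ≤ Real.exp (Real.pi * ‖z‖) := by
        rw [Complex.sin, norm_div, norm_mul]
        simp only [norm_I, mul_one, Complex.norm_ofNat]
        have a1 := Complex.norm_exp_le_exp_norm (-(Real.pi * z) * I)
        have a2 := Complex.norm_exp_le_exp_norm ((Real.pi * z) * I)
        simp only [norm_mul, norm_neg, norm_I, mul_one, Complex.norm_real, Real.norm_eq_abs,
          abs_of_pos Real.pi_pos] at a1 a2
        have := norm_sub_le (cexp (-(Real.pi * z) * I)) (cexp ((Real.pi * z) * I))
        linarith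
      have e4 : ‖Complex.Gamma (1 - z)‖ ≤ M := by
        have b1 : (1 - z).re = 1 - z.re := by simp
        refine (norm_Gamma_le' _ (by rw [b1]; linarith)).trans ?_
        rw [b1]
        exact (le_abs_self _).trans ((h2 (1 - z.re) ⟨by linarith, by linarith⟩).trans hM2)
      rw [e2, norm_mul, norm_div]
      apply mul_le_mul e4 _ (by positivity) hM0
      have : (1:ℝ) ≤ ‖(Real.pi : ℂ)‖ := by
        rw [Complex.norm_real, Real.norm_eq_abs, abs_of_pos Real.pi_pos]
        linarith [Real.pi_gt_three]
      exact (div_le_self (norm_nonneg _) this).trans e3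
    | succ n ih =>
      intro z hz1 hz2
      push_cast at hz2
      by_cases hz3 : z.re ≤ 1/2 + n
      · exact ih z hz1 hz3
      push Not at hz3
      have hn : (0:ℝ) ≤ n := n.cast_nonneg
      by_cases hz : ‖z‖ ≤ 2
      · have := h1 z (by simpa using hz)
        refine this.trans (hM1.trans ?_)
        have : 1 ≤ Real.exp (Real.pi * ‖z‖) := Real.one_le_exp (by positivity)
        nlinarith
      · push Not at hz
        have hb : 1 ≤ ‖z - 1‖ := by
          have := norm_sub_norm_le z 1
          simp only [norm_one] at this
          linarith
        have hne : z - 1 ≠ 0 := by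
          intro h; rw [h] at hb; simp at hb; linarith
        have hle : ‖z - 1‖ ≤ ‖z‖ := by
          rw [← abs_of_nonneg (norm_nonneg (z - 1)), ← abs_of_nonneg (norm_nonneg z), ← sq_le_sq,
            ← Complex.normSq_eq_norm_sq, ← Complex.normSq_eq_norm_sq, Complex.normSq_apply,
            Complex.normSq_apply]
          simp
          nlinarith
        have e := Complex.Gamma_add_one (z - 1) hne
        rw [sub_add_cancel] at e
        rw [e, mul_inv, norm_mul, norm_inv]
        have := ih (z - 1) (by simp; linarith) (by simp; linarith)
        calc ‖z - 1‖⁻¹ * ‖(Complex.Gamma (z - 1))⁻¹‖ ≤ 1 * (M * Real.exp (Real.pi * ‖z - 1‖)) := by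
              apply mul_le_mul (inv_le_one_of_one_le₀ hb) this (norm_nonneg _) zero_le_one
          _ ≤ _ := by rw [one_mul]; gcongr
  refine ⟨M, hM0, fun z hz => ?_⟩
  obtain ⟨n, hn⟩ := exists_nat_ge z.re
  exact key n z (by linarith) (by linarith)

lemma xi_eq (s : ℂ) (hs : 1 < s.re) : riemannXi s =
    s * (s - 1) / 2 * ((Real.pi : ℂ) ^ (-s / 2) * Complex.Gamma (s / 2) * riemannZeta s) := by
  have h0 : s ≠ 0 := by rintro rfl; simp at hs; linarith
  have h1 : s - 1 ≠ 0 := by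
    intro h
    have : s = 1 := by linear_combination h
    rw [this] at hs; simp at hs
  have h1' : 1 - s ≠ 0 := by
    intro h; apply h1; linear_combination -h
  have hg : Gammaℝ s ≠ 0 := Gammaℝ_ne_zero_of_re_pos (by linarith)
  have e := riemannZeta_def_of_ne_zero h0
  have e2 := completedRiemannZeta_eq s
  rw [eq_div_iff hg, e2, Gammaℝ_def] at e
  rw [riemannXi, mul_comm (_ * _) (riemannZeta s), e]
  field_simp
  ring

lemma pi_cpow_norm (s : ℂ) : ‖(Real.pi : ℂ) ^ s‖ = Real.pi ^ s.re :=
  norm_cpow_eq_rpow_re_of_pos Real.pi_pos s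

lemma xi_ne_zero (s : ℂ) (hs : 1 < s.re) : riemannXi s ≠ 0 := by
  rw [xi_eq s hs]
  have h0 : s ≠ 0 := by rintro rfl; simp at hs; linarith
  have h1 : s - 1 ≠ 0 := by
    intro h
    have : s = 1 := by linear_combination h
    rw [this] at hs; simp at hs
  have h2 := riemannZeta_ne_zero_of_one_le_re hs.le
  have h3 : Complex.Gamma (s/2) ≠ 0 := Complex.Gamma_ne_zero_of_re_pos (by simp; linarith)
  have h4 : (Real.pi : ℂ) ^ (-s / 2) ≠ 0 := by
    rw [← norm_ne_zero_iff, pi_cpow_norm]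
    exact (Real.rpow_pos_of_pos Real.pi_pos _).ne'
  have h5 : s * (s - 1) / 2 ≠ 0 := div_ne_zero (mul_ne_zero h0 h1) two_ne_zero
  exact mul_ne_zero h5 (mul_ne_zero (mul_ne_zero h4 h3) h2)

lemma xi_differentiable : Differentiable ℂ riemannXi := by
  have := differentiable_completedZeta₀
  unfold riemannXi
  fun_prop

lemma xi_one_sub (s : ℂ) : riemannXi (1 - s) = riemannXi s := by
  unfold riemannXi
  rw [completedRiemannZeta₀_one_sub]
  ring

lemma xi_conj (s : ℂ) : riemannXi (conj s) = conj (riemannXi s) := by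
  have e2 : conj (2:ℂ) = 2 := Complex.conj_ofNat 2
  unfold riemannXi
  rw [Lam0_conj]
  simp only [map_add, map_mul, map_div₀, map_sub, e2, map_one]

def Gr (f : ℂ → ℂ) : Prop := ∃ K B : ℝ, 0 ≤ K ∧ 0 ≤ B ∧ ∀ z : ℂ, 0 ≤ z.re →
  ‖f z‖ ≤ K * Real.exp (B * ‖z‖ ^ (3/2:ℝ))

lemma Gr.mul {f g : ℂ → ℂ} (hf : Gr f) (hg : Gr g) : Gr (fun z => f z * g z) := by
  obtain ⟨K, B, hK, hB, h⟩ := hf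
  obtain ⟨K', B', hK', hB', h'⟩ := hg
  refine ⟨K * K', B + B', by positivity, by positivity, fun z hz => ?_⟩
  rw [norm_mul]
  calc _ ≤ (K * Real.exp (B * ‖z‖ ^ (3/2:ℝ))) * (K' * Real.exp (B' * ‖z‖ ^ (3/2:ℝ))) :=
        mul_le_mul (h z hz) (h' z hz) (norm_nonneg _) (by positivity)
    _ = _ := by rw [add_mul, Real.exp_add]; ring

lemma Gr.add {f g : ℂ → ℂ} (hf : Gr f) (hg : Gr g) : Gr (fun z => f z + g z) := by
  obtain ⟨K, B, hK, hB, h⟩ := hf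
  obtain ⟨K', B', hK', hB', h'⟩ := hg
  refine ⟨K + K', B + B', by positivity, by positivity, fun z hz => ?_⟩
  have h1 : K * Real.exp (B * ‖z‖ ^ (3/2:ℝ)) ≤ K * Real.exp ((B + B') * ‖z‖ ^ (3/2:ℝ)) := by
    gcongr; linarith
  have h2 : K' * Real.exp (B' * ‖z‖ ^ (3/2:ℝ)) ≤ K' * Real.exp ((B + B') * ‖z‖ ^ (3/2:ℝ)) := by
    gcongr; linarith
  have := norm_add_le (f z) (g z)
  have := h z hz
  have := h' z hz
  rw [add_mul K]
  linarith

lemma Gr_of_exp {f : ℂ → ℂ} (K B : ℝ) (hK : 0 ≤ K) (hB : 0 ≤ B)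
    (h : ∀ z : ℂ, 0 ≤ z.re → ‖f z‖ ≤ K * Real.exp (B * ‖z‖)) : Gr f := by
  refine ⟨K * Real.exp B, B, by positivity, hB, fun z hz => (h z hz).trans ?_⟩
  rw [mul_assoc, ← Real.exp_add]
  gcongr
  have : ‖z‖ ≤ 1 + ‖z‖ ^ (3/2:ℝ) := by
    have h0 := norm_nonneg z
    rcases le_total ‖z‖ 1 with h1 | h1
    · have : 0 ≤ ‖z‖ ^ (3/2:ℝ) := by positivity
      linarith
    · have := Real.rpow_le_rpow_of_exponent_le h1 (show (1:ℝ) ≤ 3/2 by norm_num)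
      rw [Real.rpow_one] at this
      linarith
  nlinarith

lemma Gr_const (c : ℂ) : Gr (fun _ => c) :=
  Gr_of_exp ‖c‖ 0 (norm_nonneg _) le_rfl (fun z _ => by simp)

lemma Gr_id : Gr (fun z => z) :=
  Gr_of_exp 1 1 zero_le_one zero_le_one (fun z _ => by
    have := Real.add_one_le_exp ‖z‖
    simp only [one_mul]; linarith)

lemma Gr_bdd {f : ℂ → ℂ} (K : ℝ) (hK : 0 ≤ K) (h : ∀ z : ℂ, 0 ≤ z.re → ‖f z‖ ≤ K) : Gr f :=
  Gr_of_exp K 0 hK le_rfl (fun z hz => by simpa using h z hz)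

lemma Gr_Lam0 (a : ℝ) (ha : 1 < a) : Gr (fun z => completedRiemannZeta₀ (z + (1 - a))) := by
  obtain ⟨M, hM, h1⟩ := Lam0_strip (1 - a) 4
  obtain ⟨K, hK, h2⟩ := zeta_bounds 4 (by norm_num)
  refine ⟨M + (K + 2), 2, by positivity, by norm_num, fun z hz => ?_⟩
  have hE : 1 ≤ Real.exp (2 * ‖z‖ ^ (3/2:ℝ)) := Real.one_le_exp (by positivity)
  set E := Real.exp (2 * ‖z‖ ^ (3/2:ℝ)) with hEdef
  set w : ℂ := z + (1 - a) with hw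
  have hre : w.re = z.re + (1 - a) := by simp [hw]
  rcases le_total w.re 4 with h4 | h4
  · have := h1 w (by linarith) h4
    nlinarith
  · have h0 : w ≠ 0 := by intro h; rw [h] at h4; simp at h4; linarith
    have e := riemannZeta_def_of_ne_zero h0
    have hg : Gammaℝ w ≠ 0 := Gammaℝ_ne_zero_of_re_pos (by linarith)
    have e2 := completedRiemannZeta_eq w
    rw [eq_div_iff hg, e2, Gammaℝ_def] at e
    have e3 : completedRiemannZeta₀ w =
        riemannZeta w * ((Real.pi : ℂ) ^ (-w / 2) * Complex.Gamma (w / 2)) + 1 / w + 1 / (1 - w) := by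
      rw [e]; ring
    have b1 : ‖(1:ℂ) / w‖ ≤ 1 := by
      rw [norm_div, norm_one]
      apply div_le_one_of_le₀ _ (norm_nonneg _)
      exact le_trans (by linarith) (re_le_norm w)
    have b2 : ‖(1:ℂ) / (1 - w)‖ ≤ 1 := by
      rw [norm_div, norm_one]
      apply div_le_one_of_le₀ _ (norm_nonneg _)
      rw [norm_sub_rev]
      refine le_trans ?_ (re_le_norm (w - 1))
      simp; linarith
    have b3 : ‖(Real.pi : ℂ) ^ (-w / 2)‖ ≤ 1 := by
      rw [pi_cpow_norm]
      apply Real.rpow_le_one_of_one_le_of_nonpos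
      · linarith [Real.pi_gt_three]
      · simp; linarith
    have b4 : ‖Complex.Gamma (w / 2)‖ ≤ E := by
      have hr : (w / 2).re = w.re / 2 := by simp
      refine (norm_Gamma_le' _ (by rw [hr]; linarith)).trans ?_
      rw [hr]
      refine (Gamma_growth _ (by linarith)).trans ?_
      rw [hEdef]
      have := re_le_norm z
      have h9 : w.re / 2 ≤ ‖z‖ := by linarith
      gcongr
    have b5 := (h2 w h4).1
    have b6 : ‖riemannZeta w * ((Real.pi : ℂ) ^ (-w / 2) * Complex.Gamma (w / 2))‖ ≤ K * E := by
      rw [norm_mul, norm_mul]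
      apply mul_le_mul b5 _ (by positivity) hK
      calc _ ≤ 1 * E := mul_le_mul b3 b4 (norm_nonneg _) zero_le_one
        _ = E := one_mul _
    have b7 := norm_add₃_le (a := riemannZeta w * ((Real.pi : ℂ) ^ (-w / 2) * Complex.Gamma (w / 2)))
      (b := 1 / w) (c := 1 / (1 - w))
    rw [← e3] at b7
    nlinarith

lemma Gr_num (a : ℝ) (ha : 1 < a) : Gr (fun z => riemannXi (a - z)) := by
  have e : (fun z : ℂ => riemannXi (a - z)) = fun z : ℂ =>
      (z + ((1:ℂ) - a)) * (z + (-a : ℂ)) * (1/2) * completedRiemannZeta₀ (z + (1 - a)) + 1 / 2 := by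
    funext z
    rw [← xi_one_sub, riemannXi, show 1 - ((a:ℂ) - z) = z + (1 - a) by ring]
    ring
  rw [e]
  exact ((((Gr_id.add (Gr_const _)).mul (Gr_id.add (Gr_const _))).mul (Gr_const _)).mul
    (Gr_Lam0 a ha)).add (Gr_const _)

lemma Gr_den (a : ℝ) (ha : 1 < a) : Gr (fun z => (riemannXi (a + z))⁻¹) := by
  have hre : ∀ z : ℂ, ((a:ℂ) + z).re = a + z.re := fun z => by simp
  have h1 : Gr (fun z => ((a:ℂ) + z)⁻¹) := by
    refine Gr_bdd 1 zero_le_one (fun z hz => ?_)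
    rw [norm_inv]
    apply inv_le_one_of_one_le₀
    refine le_trans ?_ (re_le_norm _)
    rw [hre]; linarith
  have h2 : Gr (fun z => ((a:ℂ) + z - 1)⁻¹) := by
    refine Gr_bdd (a - 1)⁻¹ (inv_nonneg.2 (by linarith)) (fun z hz => ?_)
    rw [norm_inv]
    apply inv_anti₀ (by linarith)
    refine le_trans ?_ (re_le_norm _)
    rw [sub_re, hre, one_re]; linarith
  have h3 : Gr (fun z => ((Real.pi : ℂ) ^ (-(a + z) / 2))⁻¹) := by
    refine Gr_of_exp (Real.exp (Real.log Real.pi * a)) (Real.log Real.pi) (by positivity)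
      (Real.log_nonneg (by linarith [Real.pi_gt_three])) (fun z hz => ?_)
    rw [norm_inv, pi_cpow_norm, ← Real.rpow_neg Real.pi_pos.le, Real.rpow_def_of_pos Real.pi_pos,
      ← Real.exp_add, ← mul_add]
    have hl : 0 ≤ Real.log Real.pi := Real.log_nonneg (by linarith [Real.pi_gt_three])
    have hr : -(-((a:ℂ) + z) / 2).re = (a + z.re) / 2 := by simp; ring
    rw [hr]
    have := re_le_norm z
    gcongr
    linarith
  have h4 : Gr (fun z => (Complex.Gamma ((a + z) / 2))⁻¹) := by
    obtain ⟨M, hM, h⟩ := Gamma_inv_bound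
    refine Gr_of_exp (M * Real.exp (Real.pi * a)) Real.pi (by positivity) Real.pi_pos.le
      (fun z hz => ?_)
    have hr : (((a:ℂ) + z) / 2).re = (a + z.re) / 2 := by simp
    refine (h _ (by rw [hr]; linarith)).trans ?_
    rw [mul_assoc, ← Real.exp_add, ← mul_add]
    have hp := Real.pi_pos
    have h8 := norm_add_le (a:ℂ) z
    rw [Complex.norm_real, Real.norm_eq_abs, abs_of_pos (by linarith)] at h8
    have : ‖((a:ℂ) + z) / 2‖ ≤ a + ‖z‖ := by
      rw [norm_div, Complex.norm_ofNat]
      have := norm_nonneg ((a:ℂ) + z)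
      linarith
    gcongr
  have h5 : Gr (fun z => (riemannZeta (a + z))⁻¹) := by
    obtain ⟨K, hK, h⟩ := zeta_bounds a ha
    exact Gr_bdd K hK (fun z hz => (h _ (by rw [hre]; linarith)).2)
  obtain ⟨K, B, hK, hB, h⟩ := ((Gr_const 2).mul (h1.mul h2)).mul ((h3.mul h4).mul h5)
  refine ⟨K, B, hK, hB, fun z hz => ?_⟩
  convert h z hz using 2
  beta_reduce
  rw [xi_eq _ (by rw [hre]; linarith)]
  simp only [mul_inv, inv_div]
  rw [div_eq_mul_inv, mul_inv]

lemma xi_real_norm (p : ℝ) (hp : 1 < p) : ‖riemannXi p‖ =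
    p * (p - 1) / 2 * (Real.pi ^ (-p/2) * Real.Gamma (p/2) * ‖riemannZeta p‖) := by
  rw [xi_eq _ (by simpa using hp), norm_mul, norm_mul, norm_mul, pi_cpow_norm]
  have e1 : (p:ℂ) * (p - 1) / 2 = ((p * (p - 1) / 2 : ℝ) : ℂ) := by push_cast; ring
  have e2 : (p:ℂ) / 2 = ((p / 2 : ℝ) : ℂ) := by push_cast; ring
  have e3 : (-(p:ℂ) / 2).re = -p/2 := by simp
  rw [e1, e3, e2, Complex.Gamma_ofReal, Complex.norm_real, Complex.norm_real, Real.norm_eq_abs,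
    Real.norm_eq_abs, abs_of_nonneg, abs_of_nonneg]
  · exact (Real.Gamma_pos_of_pos (by linarith)).le
  · have : 0 < p - 1 := by linarith
    positivity

lemma xi_real_ratio (c : ℝ) (hc : 0 ≤ c) : ∃ C : ℝ, ∀ p : ℝ, 4 ≤ p →
    ‖riemannXi p‖ ≤ C * ‖riemannXi ((p + c : ℝ) : ℂ)‖ := by
  obtain ⟨K, hK, h⟩ := zeta_bounds 4 (by norm_num)
  refine ⟨Real.pi ^ (c/2) * (K * K), fun p hp => ?_⟩
  rw [xi_real_norm p (by linarith), xi_real_norm (p + c) (by linarith)]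
  have hp1 : 0 < p - 1 := by linarith
  have g1 : Real.Gamma (p/2) ≤ Real.Gamma ((p+c)/2) :=
    Real.Gamma_strictMonoOn_Ici.monotoneOn (by simp only [mem_Ici]; linarith)
      (by simp only [mem_Ici]; linarith) (by linarith)
  have g0 : 0 ≤ Real.Gamma (p/2) := (Real.Gamma_pos_of_pos (by linarith)).le
  have g2 : Real.pi ^ (-p/2) = Real.pi ^ (c/2) * Real.pi ^ (-(p+c)/2) := by
    rw [← Real.rpow_add Real.pi_pos]; congr 1; ring
  have z1 : ‖riemannZeta p‖ ≤ K := (h p (by simpa using hp)).1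
  have z2 : 1 ≤ K * ‖riemannZeta ((p + c : ℝ) : ℂ)‖ := by
    have hq : 4 ≤ ((p + c : ℝ) : ℂ).re := by rw [ofReal_re]; linarith
    have z3 := (h _ hq).2
    have z4 : riemannZeta ((p + c : ℝ) : ℂ) ≠ 0 :=
      riemannZeta_ne_zero_of_one_le_re (by linarith)
    have z5 : 0 < ‖riemannZeta ((p + c : ℝ) : ℂ)‖ := norm_pos_iff.2 z4
    rw [norm_inv] at z3
    calc 1 = ‖riemannZeta ((p + c : ℝ) : ℂ)‖⁻¹ * ‖riemannZeta ((p + c : ℝ) : ℂ)‖ :=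
          (inv_mul_cancel₀ z5.ne').symm
      _ ≤ _ := by gcongr
  have z6 : ‖riemannZeta p‖ ≤ K * (K * ‖riemannZeta ((p + c : ℝ) : ℂ)‖) := by nlinarith
  have q1 : p * (p - 1) / 2 ≤ (p + c) * (p + c - 1) / 2 := by nlinarith
  rw [g2]
  have hpi : 0 < Real.pi := Real.pi_pos
  have hP : 0 ≤ Real.pi ^ (c/2) * Real.pi ^ (-(p+c)/2) := by positivity
  have q2 : 0 ≤ (p + c) * (p + c - 1) / 2 := le_trans (by positivity) q1
  calc p * (p - 1) / 2 * (Real.pi ^ (c/2) * Real.pi ^ (-(p+c)/2) * Real.Gamma (p/2) * ‖riemannZeta p‖)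
      ≤ (p + c) * (p + c - 1) / 2 * (Real.pi ^ (c/2) * Real.pi ^ (-(p+c)/2) * Real.Gamma ((p+c)/2)
        * (K * (K * ‖riemannZeta ((p + c : ℝ) : ℂ)‖))) := by
        have g3 : 0 ≤ Real.Gamma ((p+c)/2) := g0.trans g1
        gcongr
    _ = _ := by ring

lemma xi_reflect (a : ℝ) (ha : 1 < a) (z : ℂ) (hz : 0 ≤ z.re) :
    ‖riemannXi (a - z)‖ ≤ ‖riemannXi (a + z)‖ := by
  have hne : ∀ w : ℂ, 0 ≤ w.re → riemannXi (a + w) ≠ 0 := fun w hw =>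
    xi_ne_zero _ (by simp; linarith)
  have hd := xi_differentiable
  have key : ‖riemannXi (a - z) * (riemannXi (a + z))⁻¹‖ ≤ 1 := by
    refine PhragmenLindelof.right_half_plane_of_bounded_on_real
      (f := fun z => riemannXi (a - z) * (riemannXi (a + z))⁻¹) ?_ ?_ ?_ ?_ hz
    · apply DifferentiableOn.diffContOnCl
      rw [closure_setOfPred_lt_re]
      intro w hw
      apply DifferentiableAt.differentiableWithinAt
      apply DifferentiableAt.mul
      · fun_prop
      · apply DifferentiableAt.inv
        · fun_prop
        · exact hne w hw
    · obtain ⟨K, B, hK, hB, h⟩ := (Gr_num a ha).mul (Gr_den a ha)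
      refine ⟨3/2, by norm_num, B, Asymptotics.IsBigO.of_bound K ?_⟩
      filter_upwards [mem_inf_of_right (mem_principal_self _)] with w hw
      rw [Real.norm_eq_abs, abs_of_pos (Real.exp_pos _)]
      exact h w (le_of_lt hw)
    · obtain ⟨C, hC⟩ := xi_real_ratio (2 * a - 1) (by linarith)
      refine ⟨C, ?_⟩
      rw [eventually_map]
      filter_upwards [eventually_ge_atTop (a + 3)] with x hx
      have := hC (x + 1 - a) (by linarith)
      have e1 : ((x + 1 - a : ℝ) : ℂ) = 1 - (a - x) := by push_cast; ring
      have e2 : ((x + 1 - a + (2 * a - 1) : ℝ) : ℂ) = a + x := by push_cast; ring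
      rw [e1, e2, xi_one_sub] at this
      rw [norm_mul, norm_inv, ← div_eq_mul_inv]
      refine div_le_of_le_mul₀ (norm_nonneg _) ?_ this
      by_contra hCn
      push Not at hCn
      have p1 : 0 < ‖riemannXi (a + x)‖ := norm_pos_iff.2 (hne x (by simp; linarith))
      have p2 := norm_nonneg (riemannXi (a - x))
      nlinarith
    · intro x
      have e : (a:ℂ) - x * I = conj (a + x * I) := by simp; ring
      rw [e, xi_conj, norm_mul, norm_conj, norm_inv]
      exact mul_inv_le_one
  have p1 : 0 < ‖riemannXi (a + z)‖ := norm_pos_iff.2 (hne z hz)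
  rw [norm_mul, norm_inv, ← div_eq_mul_inv, div_le_one p1] at key
  exact key

lemma xi_horiz (s : ℂ) (hs : 1 < s.re) (h : ℝ) (hh : 0 ≤ h) :
    ‖riemannXi (s - h)‖ ≤ ‖riemannXi (s + h)‖ := by
  have := xi_reflect s.re hs (h + s.im * I) (by simpa using hh)
  have e1 : (s.re : ℂ) - (h + s.im * I) = conj (s - h) := by
    apply Complex.ext <;> simp
  have e2 : (s.re : ℂ) + (h + s.im * I) = s + h := by
    apply Complex.ext <;> simp
  rwa [e1, e2, xi_conj, norm_conj] at this

lemma xi_logderiv_nonneg (s : ℂ) (hs : 1 < s.re) : 0 ≤ (deriv riemannXi s / riemannXi s).re := by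
  have hd := (xi_differentiable s).hasDerivAt
  have hp : HasDerivAt (fun h : ℝ => riemannXi (s + h)) (deriv riemannXi s) 0 := by
    have h1 : HasDerivAt (fun h : ℂ => riemannXi (s + h)) (deriv riemannXi s) ((0:ℝ):ℂ) := by
      apply HasDerivAt.comp_const_add
      simpa using hd
    exact h1.comp_ofReal
  have hm : HasDerivAt (fun h : ℝ => riemannXi (s - h)) (-deriv riemannXi s) 0 := by
    have h1 : HasDerivAt (fun h : ℂ => riemannXi (s - h)) (-deriv riemannXi s) ((0:ℝ):ℂ) := by
      apply HasDerivAt.comp_const_sub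
      simpa using hd
    exact h1.comp_ofReal
  have hφ := hp.norm_sq.sub hm.norm_sq
  have ht := hφ.tendsto_slope_zero_right
  have hnn := ge_of_tendsto (b := 0) ht (by
    filter_upwards [self_mem_nhdsWithin] with h hh
    have hh : 0 < h := hh
    have := xi_horiz s hs h hh.le
    simp only [Pi.sub_apply, zero_add, ofReal_zero, add_zero, sub_zero, sub_self, smul_eq_mul]
    have h0 := norm_nonneg (riemannXi (s - h))
    have : 0 ≤ ‖riemannXi (s + h)‖ ^ 2 - ‖riemannXi (s - h)‖ ^ 2 := by nlinarith
    positivity)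
  simp only [ofReal_zero, add_zero, sub_zero, inner_neg_right, Complex.inner] at hnn
  rw [div_eq_mul_inv, Complex.inv_def, ← mul_assoc, re_mul_ofReal]
  apply mul_nonneg _ (inv_nonneg.2 (normSq_nonneg _))
  rw [mul_comm] at hnn
  linarith

lemma xi_two : riemannXi 2 = Real.pi / 6 := by
  rw [xi_eq 2 (by simp), riemannZeta_two]
  have : (Real.pi : ℂ) ≠ 0 := by exact_mod_cast Real.pi_ne_zero
  rw [show (2:ℂ)/2 = 1 by norm_num, show -(2:ℂ)/2 = -1 by norm_num, Complex.Gamma_one, cpow_neg_one]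
  field_simp
  norm_num

lemma xi_four : riemannXi 4 = Real.pi ^ 2 / 15 := by
  rw [xi_eq 4 (by simp), riemannZeta_four]
  have : (Real.pi : ℂ) ≠ 0 := by exact_mod_cast Real.pi_ne_zero
  have hG : Complex.Gamma 2 = 1 := by
    have := Complex.Gamma_nat_eq_factorial 1
    rw [Nat.factorial_one, Nat.cast_one, one_add_one_eq_two] at this
    exact this
  rw [show (4:ℂ)/2 = 2 by norm_num, show -(4:ℂ)/2 = -2 by norm_num, hG, cpow_neg, cpow_ofNat]
  field_simp
  norm_num

lemma xi_deriv_ne_zero (s : ℂ) (hs : 1 < s.re) : deriv riemannXi s ≠ 0 := by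
  intro h0
  have hU : IsOpen {z : ℂ | 1 < z.re} := isOpen_lt continuous_const continuous_re
  have hC : IsPreconnected {z : ℂ | 1 < z.re} := (convex_halfSpace_re_gt 1).isPreconnected
  have hA : AnalyticOnNhd ℂ (fun z => deriv riemannXi z / riemannXi z) {z : ℂ | 1 < z.re} := by
    intro z hz
    have := xi_differentiable.analyticAt z
    exact this.deriv.div this (xi_ne_zero z hz)
  rcases hA.is_constant_or_isOpen hC with ⟨w, hw⟩ | ho
  · have hw0 : w = 0 := by rw [← hw s hs]; simp [h0]
    have hz : EqOn (deriv riemannXi) 0 {z : ℂ | 1 < z.re} := by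
      intro z hz
      have := hw z hz
      rw [hw0, div_eq_zero_iff] at this
      exact this.resolve_right (xi_ne_zero z hz)
    have := hU.is_const_of_deriv_eq_zero hC xi_differentiable.differentiableOn hz
      (x := 2) (y := 4) (by simp) (by simp)
    rw [xi_two, xi_four] at this
    have h2 : Real.pi / 6 = Real.pi ^ 2 / 15 := by exact_mod_cast this
    have := Real.pi_gt_three
    nlinarith
  · have := ho _ subset_rfl hU
    have hm : (0:ℂ) ∈ (fun z => deriv riemannXi z / riemannXi z) '' {z : ℂ | 1 < z.re} :=
      ⟨s, hs, by simp [h0]⟩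
    obtain ⟨ε, hε, hb⟩ := Metric.isOpen_iff.1 this 0 hm
    obtain ⟨z, hz, hz2⟩ := hb (show ((-(ε/2) : ℝ) : ℂ) ∈ Metric.ball 0 ε by
      rw [mem_ball_zero_iff, Complex.norm_real, Real.norm_eq_abs, abs_neg, abs_of_pos (by linarith)]
      linarith)
    have h1 := xi_logderiv_nonneg z hz
    simp only at hz2
    rw [hz2, ofReal_re] at h1
    linarith

theorem zeros_of_deriv_xi_in_critical_strip (s : ℂ)
    (h : deriv riemannXi s = 0) : 0 ≤ s.re ∧ s.re ≤ 1 := by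
  constructor
  · by_contra hc
    push Not at hc
    apply xi_deriv_ne_zero (1 - s) (by simp; linarith)
    have e : (fun z => riemannXi (1 - z)) = riemannXi := funext xi_one_sub
    have := deriv_comp_const_sub (f := riemannXi) 1 s
    rw [e, h] at this
    simpa using this.symm
  · by_contra hc
    push Not at hc
    exact xi_deriv_ne_zero s hc h
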